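/- arXiv:1809.01363 — 5 statements merged into one kernel-verified Lean document; each statement's English description precedes it below -/
import Mathlib

section
/- Let p be a prime and let f be a polynomial with coefficients in ℤ_p, viewed as a map f : ℤ_p → ℤ_p. The following are equivalent: (1) (ℤ_p, f) is minimal, i.e., for every x ∈ ℤ_p the forward orbit {fᵏ(x) : k ≥ 0} is dense in ℤ_p; (2) for every n ≥ 1 the induced map f_/n on ℤ/pⁿℤ is minimal, i.e., every forward orbit of f_/n is all of ℤ/pⁿℤ; (3) for every n ≥ 1 the induced map f_/n has a full cycle in ℤ/pⁿℤ, i.e., there exists x ∈ ℤ/pⁿℤ such that the points x, f_/n(x), …, f_/n^(pⁿ−1)(x) exhaust all of ℤ/pⁿℤ. -/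
open Polynomial

namespace Function

theorem exists_lt_card_iterate_eq {α : Type*} [Fintype α] {g : α → α}
    (h : ∀ x y, ∃ k : ℕ, g^[k] x = y) (x y : α) : ∃ k : ℕ, k < Fintype.card α ∧ g^[k] x = y := by
  obtain ⟨k, hk⟩ := h (g x) x
  have hx : x ∈ periodicPts g := mk_mem_periodicPts k.succ_pos hk
  obtain ⟨j, hj⟩ := h x y
  exact ⟨j % minimalPeriod g x,
    (Nat.mod_lt _ (minimalPeriod_pos_of_mem_periodicPts hx)).trans_le minimalPeriod_le_card,
    iterate_mod_minimalPeriod_eq.trans hj⟩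

theorem Surjective.exists_iterate_eq_of_orbit {α : Type*} [Finite α] {g : α → α}
    (hg : Surjective g) {x : α} (hx : ∀ y, ∃ k : ℕ, g^[k] x = y) (y z : α) :
    ∃ k : ℕ, g^[k] y = z := by
  obtain ⟨m, hm, hper⟩ := (Finite.injective_iff_surjective.2 hg).mem_periodicPts x
  obtain ⟨a, rfl⟩ := hx y
  obtain ⟨b, rfl⟩ := hx z
  refine ⟨b + (m * a - a), ?_⟩
  rw [← iterate_add_apply, add_assoc, Nat.sub_add_cancel (Nat.le_mul_of_pos_left a hm),
    iterate_add_apply, (hper.mul_const a).eq]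

end Function

namespace PadicInt

theorem toZModPow_eq_iff_norm_sub_le {p : ℕ} [Fact p.Prime] (n : ℕ) (x y : ℤ_[p]) :
    toZModPow n x = toZModPow n y ↔ ‖x - y‖ ≤ (p : ℝ) ^ (-n : ℤ) := by
  rw [norm_le_pow_iff_mem_span_pow, ← ker_toZModPow, RingHom.mem_ker, map_sub, sub_eq_zero]

theorem denseRange_iff_toZModPow {p : ℕ} [Fact p.Prime] {ι : Type*} (u : ι → ℤ_[p]) :
    DenseRange u ↔ ∀ n : ℕ, 1 ≤ n → ∀ y : ZMod (p ^ n), ∃ i, toZModPow n (u i) = y := by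
  have hp : 1 < (p : ℝ) := mod_cast (Fact.out : p.Prime).one_lt
  constructor
  · intro h n _ y
    obtain ⟨z, rfl⟩ := ZMod.ringHom_surjective (toZModPow (p := p) n) y
    obtain ⟨i, hi⟩ := h.exists_dist_lt z (zpow_pos (zero_lt_one.trans hp) (-n : ℤ))
    exact ⟨i, ((toZModPow_eq_iff_norm_sub_le n z (u i)).2 (dist_eq_norm z (u i) ▸ hi.le)).symm⟩
  · intro h z
    rw [Metric.mem_closure_range_iff]
    intro ε hε
    obtain ⟨m, hm⟩ := exists_pow_neg_lt p hε
    obtain ⟨i, hi⟩ := h (m + 1) (Nat.le_add_left 1 m) (toZModPow (m + 1) z)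
    refine ⟨i, lt_of_le_of_lt ?_ hm⟩
    rw [dist_eq_norm]
    refine ((toZModPow_eq_iff_norm_sub_le _ _ _).1 hi.symm).trans (zpow_le_zpow_right₀ hp.le ?_)
    push_cast
    lia

theorem toZModPow_iterate_eval {p : ℕ} [Fact p.Prime] (f : ℤ_[p][X]) (n k : ℕ) (x : ℤ_[p]) :
    toZModPow n ((fun z => f.eval z)^[k] x) =
      (fun z => (f.map (toZModPow n)).eval z)^[k] (toZModPow n x) :=
  Function.Semiconj.iterate_right (f := toZModPow n)
    (fun z => (Polynomial.eval_map_apply (toZModPow n) z).symm) k x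

/-- Modulo `p ^ (n + 1)`, every point of the orbit of `x` other than `x` is in the image, while
every residue class modulo `p ^ n` has at least two lifts modulo `p ^ (n + 1)`. -/
theorem surjective_eval_map_toZModPow_of_orbit {p : ℕ} [Fact p.Prime] (f : ℤ_[p][X]) (n : ℕ)
    {x : ZMod (p ^ (n + 1))}
    (hx : ∀ y, ∃ k : ℕ, (fun z => (f.map (toZModPow (n + 1))).eval z)^[k] x = y) :
    Function.Surjective fun z : ZMod (p ^ n) => (f.map (toZModPow n)).eval z := by
  intro y
  have hp : toZModPow (n + 1) ((p : ℤ_[p]) ^ n) ≠ 0 := by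
    rw [← Nat.cast_pow, map_natCast, Ne, ZMod.natCast_eq_zero_iff,
      Nat.pow_dvd_pow_iff_le_right (Fact.out : p.Prime).one_lt]
    lia
  obtain ⟨w, hwx, rfl⟩ : ∃ w : ℤ_[p], toZModPow (n + 1) w ≠ x ∧ toZModPow n w = y := by
    obtain ⟨w, rfl⟩ := ZMod.ringHom_surjective (toZModPow (p := p) n) y
    by_cases hw : toZModPow (n + 1) w = x
    · refine ⟨w + (p : ℤ_[p]) ^ n, by simpa [hw] using hp, ?_⟩
      rw [map_add, ← Nat.cast_pow, map_natCast, ZMod.natCast_self, add_zero]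
    · exact ⟨w, hw, rfl⟩
  obtain ⟨_ | k, hk⟩ := hx (toZModPow (n + 1) w)
  · exact absurd hk.symm hwx
  obtain ⟨v, hv⟩ := ZMod.ringHom_surjective (toZModPow (p := p) (n + 1))
    ((fun z => (f.map (toZModPow (n + 1))).eval z)^[k] x)
  rw [Function.iterate_succ_apply', ← hv] at hk
  refine ⟨toZModPow n v, ?_⟩
  simp only [eval_map_apply] at hk ⊢
  rw [← cast_toZModPow n (n + 1) n.le_succ, hk, cast_toZModPow n (n + 1) n.le_succ]

end PadicInt

/-- For a prime `p` and a polynomial `f` over `ℤ_[p]`, the following are equivalent: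
(1) every forward orbit of `f` is dense in `ℤ_[p]`;
(2) for every `n ≥ 1`, the induced map `f_/n` on `ℤ/pⁿℤ` is minimal;
(3) for every `n ≥ 1`, the induced map `f_/n` has a full cycle in `ℤ/pⁿℤ`. -/
theorem stmt_1 (p : ℕ) [Fact p.Prime] (f : Polynomial ℤ_[p]) :
    ((∀ x : ℤ_[p], Dense (Set.range fun k : ℕ => (fun z : ℤ_[p] => f.eval z)^[k] x)) ↔
      (∀ n : ℕ, 1 ≤ n → ∀ x y : ZMod (p ^ n),
        ∃ k : ℕ, (fun z : ZMod (p ^ n) => (f.map (PadicInt.toZModPow n)).eval z)^[k] x = y)) ∧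
    ((∀ x : ℤ_[p], Dense (Set.range fun k : ℕ => (fun z : ℤ_[p] => f.eval z)^[k] x)) ↔
      (∀ n : ℕ, 1 ≤ n → ∃ x : ZMod (p ^ n), ∀ y : ZMod (p ^ n),
        ∃ k : ℕ, k < p ^ n ∧
          (fun z : ZMod (p ^ n) => (f.map (PadicInt.toZModPow n)).eval z)^[k] x = y)) := by
  have dense_iff : (∀ x : ℤ_[p], Dense (Set.range fun k : ℕ => (fun z : ℤ_[p] => f.eval z)^[k] x)) ↔
      (∀ n : ℕ, 1 ≤ n → ∀ x y : ZMod (p ^ n),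
        ∃ k : ℕ, (fun z : ZMod (p ^ n) => (f.map (PadicInt.toZModPow n)).eval z)^[k] x = y) := by
    have dense_orbit_iff (x : ℤ_[p]) := PadicInt.denseRange_iff_toZModPow
      fun k : ℕ => (fun z : ℤ_[p] => f.eval z)^[k] x
    simp only [DenseRange, PadicInt.toZModPow_iterate_eval] at dense_orbit_iff
    simp only [dense_orbit_iff]
    refine ⟨fun h n hn x => ?_, fun h x n hn => h n hn _⟩
    obtain ⟨z, rfl⟩ := ZMod.ringHom_surjective (PadicInt.toZModPow (p := p) n) x
    exact h z n hn
  refine ⟨dense_iff, dense_iff.trans ⟨fun h n hn => ?_, fun h n hn => ?_⟩⟩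
  all_goals have : NeZero (p ^ n) := ⟨pow_ne_zero n (Fact.out : p.Prime).ne_zero⟩
  · exact ⟨0, by simpa only [ZMod.card] using Function.exists_lt_card_iterate_eq (h n hn) 0⟩
  · obtain ⟨x, hx⟩ := h n hn
    obtain ⟨x', hx'⟩ := h (n + 1) (Nat.le_add_left 1 n)
    exact (PadicInt.surjective_eval_map_toZModPow_of_orbit f n
      fun y => (hx' y).imp fun _ => And.right).exists_iterate_eq_of_orbit
        fun y => (hx y).imp fun _ => And.right
end

section
/- Let f(x) = 1 + a₁x + a₂x² + ⋯ + a_d x^d be a polynomial with coefficients in ℤ₂ and constant term 1. Set A₁ = Σ_{i ≥ 1, i odd} a_i and A₂ = Σ_{i ≥ 2, i even} a_i. Then (ℤ₂, f) is minimal if and only if: a₁ ≡ 1 (mod 2), A₁ ≡ 1 (mod 2), A₁ + A₂ ≡ 1 (mod 4), and 2a₂ + a₁A₁ ≡ 1 (mod 4). -/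
open Polynomial

namespace PadicInt

theorem two_dvd_or_two_dvd_sub_one (x : ℤ_[2]) : (2 : ℤ_[2]) ∣ x ∨ (2 : ℤ_[2]) ∣ x - 1 := by
  obtain ⟨n, hn, hx⟩ := PadicInt.exists_mem_range x
  rw [PadicInt.maximalIdeal_eq_span_p, Ideal.mem_span_singleton] at hx
  interval_cases n
  · left; simpa using hx
  · right; simpa using hx

theorem not_two_dvd_one : ¬ (2 : ℤ_[2]) ∣ 1 := by
  intro h
  have := PadicInt.prime_p (p := 2)
  exact this.not_isUnit (isUnit_of_dvd_one (by exact_mod_cast h))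

theorem not_four_dvd_two : ¬ (4 : ℤ_[2]) ∣ 2 := by
  rintro ⟨c, hc⟩
  refine not_two_dvd_one ⟨c, mul_left_cancel₀ (two_ne_zero (α := ℤ_[2])) ?_⟩
  linear_combination hc

theorem not_eight_dvd_four : ¬ (8 : ℤ_[2]) ∣ 4 := by
  rintro ⟨c, hc⟩
  refine not_four_dvd_two ⟨c, mul_left_cancel₀ (two_ne_zero (α := ℤ_[2])) ?_⟩
  linear_combination hc

theorem dense_iff_forall_exists_pow_dvd_sub (s : Set ℤ_[2]) :
    Dense s ↔ ∀ (y : ℤ_[2]) (n : ℕ), ∃ z ∈ s, (2 : ℤ_[2]) ^ n ∣ z - y := by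
  have key : ∀ (z : ℤ_[2]) (n : ℕ), ‖z‖ ≤ (2 : ℝ) ^ (-n : ℤ) ↔ (2 : ℤ_[2]) ^ n ∣ z := by
    intro z n
    have := PadicInt.norm_le_pow_iff_mem_span_pow z n
    rw [Ideal.mem_span_singleton] at this
    exact_mod_cast this
  rw [Metric.dense_iff]
  constructor
  · intro h y n
    obtain ⟨z, hz, hzs⟩ := h y ((2 : ℝ) ^ (-n : ℤ)) (by positivity)
    refine ⟨z, hzs, (key _ _).1 ?_⟩
    rw [Metric.mem_ball, dist_eq_norm] at hz
    exact hz.le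
  · intro h y r hr
    obtain ⟨n, hn⟩ := PadicInt.exists_pow_neg_lt 2 hr
    obtain ⟨z, hzs, hz⟩ := h y n
    refine ⟨z, ?_, hzs⟩
    rw [Metric.mem_ball, dist_eq_norm]
    exact ((key _ _).2 hz).trans_lt (by exact_mod_cast hn)

end PadicInt

namespace Polynomial

theorem exists_eval_eq_cubic_remainder {R : Type*} [CommRing R] (p : R[X]) (h : R) :
    ∃ k, p.eval h = p.coeff 0 + p.coeff 1 * h + p.coeff 2 * h ^ 2 + k * h ^ 3 := by
  refine ⟨p.divX.divX.divX.eval h, ?_⟩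
  have e : ∀ q : R[X], q.eval h = q.divX.eval h * h + q.coeff 0 := fun q => by
    conv_lhs => rw [← divX_mul_X_add q]
    simp
  rw [e p, e p.divX, e p.divX.divX]
  simp only [coeff_divX]
  ring

theorem exists_eval_one_add_eq_cubic_remainder {R : Type*} [CommRing R] (p : R[X]) (h : R) :
    ∃ k, p.eval (1 + h) = p.eval 1 + p.derivative.eval 1 * h +
      (hasseDeriv 2 p).eval 1 * h ^ 2 + k * h ^ 3 := by
  obtain ⟨k, hk⟩ := exists_eval_eq_cubic_remainder (taylor 1 p) h
  refine ⟨k, ?_⟩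
  rw [taylor_eval, taylor_coeff_zero, taylor_coeff_one, taylor_coeff] at hk
  rw [add_comm, hk]

theorem four_dvd_eval_derivative_sub {R : Type*} [CommRing R] (p : R[X]) {x y : R}
    (h : 2 ∣ y - x) : (4 : R) ∣ p.derivative.eval y - p.derivative.eval x := by
  obtain ⟨c, hc⟩ := h
  obtain ⟨k, hk⟩ := p.derivative.binomExpansion x (2 * c)
  have h2 : p.derivative.derivative.eval x = 2 * (hasseDeriv 2 p).eval x := by
    have := congrArg (fun q : R[X] => q.eval x)
      (congrFun (factorial_smul_hasseDeriv (R := R) 2) p)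
    simpa using this.symm
  have hy : y = x + 2 * c := by linear_combination hc
  rw [hy, hk, h2]
  exact ⟨(hasseDeriv 2 p).eval x * c + k * c ^ 2, by ring⟩

theorem four_dvd_eval_one_derivative_add {R : Type*} [CommRing R] (p : R[X]) :
    (4 : R) ∣ p.derivative.eval 1 + 2 * (hasseDeriv 2 p).eval 1 -
      ∑ i ∈ (Finset.range (p.natDegree + 1)).filter (fun i => i % 2 = 1), p.coeff i := by
  have h1 : p.derivative.eval 1 = ∑ i ∈ Finset.range (p.natDegree + 1), p.coeff i * i := by
    rw [derivative_eval, sum_over_range _ (by simp)]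
    simp
  have h2 : (hasseDeriv 2 p).eval 1 =
      ∑ i ∈ Finset.range (p.natDegree + 1), (i.choose 2 : R) * p.coeff i := by
    rw [hasseDeriv_apply, sum_over_range _ (by simp), eval_finsetSum]
    simp
  rw [h1, h2, Finset.mul_sum, Finset.sum_filter, ← Finset.sum_add_distrib,
    ← Finset.sum_sub_distrib]
  refine Finset.dvd_sum fun i _ => ?_
  have hi : (i : R) + 2 * (i.choose 2 : R) = (i : R) ^ 2 := by
    have : i + 2 * i.choose 2 = i ^ 2 := by
      rw [Nat.choose_two_right, mul_comm, ← Finset.sum_range_id, Finset.sum_range_id_mul_two]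
      cases i with
      | zero => simp
      | succ j => simp only [Nat.add_sub_cancel]; ring
    exact_mod_cast congrArg (Nat.cast (R := R)) this
  split_ifs with h
  · obtain ⟨j, rfl⟩ : ∃ j, i = 2 * j + 1 := ⟨i / 2, by omega⟩
    refine ⟨(j ^ 2 + j) * p.coeff (2 * j + 1), ?_⟩
    push_cast at hi ⊢
    linear_combination p.coeff (2 * j + 1) * hi
  · obtain ⟨j, rfl⟩ : ∃ j, i = 2 * j := ⟨i / 2, by omega⟩
    refine ⟨j ^ 2 * p.coeff (2 * j), ?_⟩
    push_cast at hi ⊢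
    linear_combination p.coeff (2 * j) * hi

theorem eval_one_eq_coeff_zero_add_odd_add_even {R : Type*} [CommRing R] (p : R[X]) :
    p.eval 1 = p.coeff 0 +
      ((∑ i ∈ (Finset.range (p.natDegree + 1)).filter (fun i => i % 2 = 1), p.coeff i) +
        ∑ i ∈ (Finset.range (p.natDegree + 1)).filter (fun i => i % 2 = 0 ∧ i ≠ 0),
          p.coeff i) := by
  have h0 : p.coeff 0 = ∑ i ∈ Finset.range (p.natDegree + 1), if i = 0 then p.coeff i else 0 := by
    simp
  rw [h0, Finset.sum_filter, Finset.sum_filter, ← Finset.sum_add_distrib,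
    ← Finset.sum_add_distrib, eval_eq_sum_range]
  refine Finset.sum_congr rfl fun i _ => ?_
  rcases Nat.mod_two_eq_zero_or_one i with h | h
  · by_cases hi : i = 0 <;> simp [h, hi]
  · have hi : i ≠ 0 := by omega
    simp [h, hi]

/-- The `2 ^ n`-th iterate of `f` under composition. -/
noncomputable def doublingIterate {R : Type*} [CommRing R] (f : R[X]) : ℕ → R[X]
  | 0 => f
  | n + 1 => (doublingIterate f n).comp (doublingIterate f n)

theorem eval_doublingIterate {R : Type*} [CommRing R] (f : R[X]) (n : ℕ) (x : R) :
    (f.doublingIterate n).eval x = (fun z => f.eval z)^[2 ^ n] x := by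
  induction n generalizing x with
  | zero => simp [doublingIterate]
  | succ n ih =>
    rw [doublingIterate, eval_comp, ih, ih, ← Function.iterate_add_apply, pow_succ, mul_two]

theorem dvd_iterate_eval_sub {R : Type*} [CommRing R] (f : R[X]) {N x y : R} (h : N ∣ x - y)
    (k : ℕ) : N ∣ (fun z => f.eval z)^[k] x - (fun z => f.eval z)^[k] y := by
  induction k with
  | zero => simpa using h
  | succ k ih =>
    rw [Function.iterate_succ_apply', Function.iterate_succ_apply']
    exact ih.trans (sub_dvd_eval_sub _ _ f)

/-- If `s` is periodic modulo `N` and its orbit visits the class of `y`, then it does so within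
one period. -/
theorem exists_lt_dvd_iterate_eval_sub {R : Type*} [CommRing R] (f : R[X]) {N s y : R} {m : ℕ}
    (hm : 0 < m) (hs : N ∣ (fun z => f.eval z)^[m] s - s)
    (hy : ∃ k, N ∣ (fun z => f.eval z)^[k] s - y) :
    ∃ k < m, N ∣ (fun z => f.eval z)^[k] s - y := by
  classical
  refine ⟨Nat.find hy, ?_, Nat.find_spec hy⟩
  by_contra! hlt
  obtain ⟨j, hj⟩ := Nat.exists_eq_add_of_le' hlt
  refine Nat.find_min hy (m := j) (by omega) ?_
  have h1 := Nat.find_spec hy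
  rw [hj, Function.iterate_add_apply] at h1
  simpa using dvd_sub h1 (f.dvd_iterate_eval_sub hs j)

/-- The fourth iterate of `0` modulo `8`. -/
theorem eight_dvd_eval_four_sub {f : ℤ_[2][X]} (hf0 : f.coeff 0 = 1) {A : ℤ_[2]}
    (hA : 4 ∣ f.derivative.eval 1 + 2 * (hasseDeriv 2 f).eval 1 - A)
    (ha1 : 2 ∣ f.coeff 1 - 1) (hA1 : 2 ∣ A - 1) (hF : 4 ∣ f.eval 1 - 2) :
    8 ∣ f.eval (f.eval (f.eval (f.eval 0))) - 2 * (1 + f.coeff 1 * A + 2 * f.coeff 2) := by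
  obtain ⟨r, hr⟩ := hA
  obtain ⟨b, hb⟩ := ha1
  obtain ⟨c, hc⟩ := hA1
  obtain ⟨t, ht⟩ := hF
  have hF : f.eval 1 = 2 * (1 + 2 * t) := by linear_combination ht
  obtain ⟨k, hk⟩ := exists_eval_eq_cubic_remainder f (f.eval 1)
  have e0 : f.eval 0 = 1 := by rw [← coeff_zero_eq_eval_zero, hf0]
  set e := 2 * f.coeff 2 * (t + t ^ 2) + k * (1 + 2 * t) ^ 3 with he
  set H := (1 + 2 * t) * f.coeff 1 + 2 * f.coeff 2 + 4 * e with hH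
  have h3 : f.eval (f.eval 1) = 1 + 2 * H := by
    rw [hk, hf0, hF, hH, he]; ring
  obtain ⟨k', hk'⟩ := exists_eval_one_add_eq_cubic_remainder f (2 * H)
  obtain ⟨q, hq⟩ : 2 ∣ H - 1 :=
    ⟨t * f.coeff 1 + b + f.coeff 2 + 2 * e, by rw [hH]; linear_combination hb⟩
  obtain ⟨z, hz⟩ : 2 ∣ f.coeff 1 * A - 1 :=
    ⟨b * A + c, by linear_combination A * hb + hc⟩
  rw [e0, h3, hk', hF]
  refine ⟨t * (1 + z) + f.coeff 2 * c + e * A + r * H + (hasseDeriv 2 f).eval 1 * H * q +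
    k' * H ^ 3, ?_⟩
  linear_combination 2 * H * hr + 4 * (hasseDeriv 2 f).eval 1 * H * hq + 4 * t * hz +
    4 * f.coeff 2 * hc + 2 * A * hH

theorem two_dvd_eval_derivative_sub_one {f : ℤ_[2][X]} (ha1 : 2 ∣ f.coeff 1 - 1)
    (hd : 2 ∣ f.derivative.eval 1 - 1) (x : ℤ_[2]) : 2 ∣ f.derivative.eval x - 1 := by
  rcases PadicInt.two_dvd_or_two_dvd_sub_one x with hx | hx
  · have h0 : f.derivative.eval 0 = f.coeff 1 := by
      rw [← coeff_zero_eq_eval_zero, coeff_derivative]; simp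
    have := (show (2 : ℤ_[2]) ∣ x - 0 by simpa using hx).trans (sub_dvd_eval_sub x 0 f.derivative)
    rw [h0] at this
    simpa using dvd_add this ha1
  · simpa using dvd_add (hx.trans (sub_dvd_eval_sub x 1 f.derivative)) hd

theorem two_dvd_eval_sub_add_one {f : ℤ_[2][X]} (hf0 : f.coeff 0 = 1)
    (hF : 2 ∣ f.eval 1) (x : ℤ_[2]) : 2 ∣ f.eval x - (x + 1) := by
  rcases PadicInt.two_dvd_or_two_dvd_sub_one x with hx | hx
  · have := (show (2 : ℤ_[2]) ∣ x - 0 by simpa using hx).trans (sub_dvd_eval_sub x 0 f)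
    rw [← coeff_zero_eq_eval_zero, hf0] at this
    convert dvd_sub this hx using 1
    ring
  · convert dvd_sub (dvd_add (hx.trans (sub_dvd_eval_sub x 1 f)) hF)
      (dvd_add hx (dvd_refl 2)) using 1
    ring

theorem four_dvd_eval_derivative_doublingIterate_sub_one {f : ℤ_[2][X]}
    (hd : ∀ x : ℤ_[2], 2 ∣ f.derivative.eval x - 1)
    (hs : ∀ x : ℤ_[2], 2 ∣ f.eval x - (x + 1)) (n : ℕ) (x : ℤ_[2]) :
    4 ∣ (f.doublingIterate (n + 2)).derivative.eval x - 1 := by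
  have hG : ∀ n x, (f.doublingIterate (n + 1)).derivative.eval x =
      (f.doublingIterate n).derivative.eval x *
        (f.doublingIterate n).derivative.eval ((f.doublingIterate n).eval x) := by
    intro n x
    rw [doublingIterate, derivative_comp, eval_mul, eval_comp]
  induction n generalizing x with
  | zero =>
    have h1 : (2 : ℤ_[2]) ∣ (f.doublingIterate 1).eval x - x := by
      rw [doublingIterate, doublingIterate, eval_comp]
      obtain ⟨c, hc⟩ := hs x
      obtain ⟨d, hd⟩ := hs (f.eval x)
      exact ⟨c + d + 1, by linear_combination hc + hd⟩
    obtain ⟨c, hc⟩ := four_dvd_eval_derivative_sub (f.doublingIterate 1) h1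
    rw [hG]
    set D := (f.doublingIterate 1).derivative.eval x with hD
    obtain ⟨d, hd⟩ : 2 ∣ D - 1 := by
      rw [hD, hG]
      obtain ⟨a, ha⟩ := hd x
      obtain ⟨b, hb⟩ := hd (f.eval x)
      rw [doublingIterate]
      exact ⟨a * f.derivative.eval (f.eval x) + b,
        by linear_combination f.derivative.eval (f.eval x) * ha + hb⟩
    refine ⟨D * c + d ^ 2 + d, ?_⟩
    linear_combination D * hc + (D + 1 + 2 * d) * hd
  | succ n ih =>
    rw [hG]
    obtain ⟨a, ha⟩ := ih x
    obtain ⟨b, hb⟩ := ih ((f.doublingIterate (n + 2)).eval x)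
    set E := (f.doublingIterate (n + 2)).derivative.eval ((f.doublingIterate (n + 2)).eval x)
    exact ⟨a * E + b, by linear_combination E * ha + hb⟩

theorem exists_doublingIterate_eval_zero {f : ℤ_[2][X]}
    (hd : ∀ (n : ℕ) (x : ℤ_[2]), 4 ∣ (f.doublingIterate (n + 2)).derivative.eval x - 1)
    (h2 : 8 ∣ (f.doublingIterate 2).eval 0 - 4) (n : ℕ) :
    ∃ v : ℤ_[2], (f.doublingIterate (n + 2)).eval 0 = 2 ^ (n + 2) * (1 + 2 * v) := by
  induction n with
  | zero =>
    obtain ⟨c, hc⟩ := h2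
    exact ⟨c, by linear_combination hc⟩
  | succ n ih =>
    obtain ⟨v, hv⟩ := ih
    obtain ⟨d, hd⟩ := hd n 0
    obtain ⟨k, hk⟩ := (f.doublingIterate (n + 2)).binomExpansion 0
      (2 ^ (n + 2) * (1 + 2 * v))
    rw [zero_add] at hk
    refine ⟨v + d * (1 + 2 * v) + k * 2 ^ n * (1 + 2 * v) ^ 2, ?_⟩
    rw [show n + 1 + 2 = n + 2 + 1 from rfl, doublingIterate, eval_comp, hv, hk]
    linear_combination hv + 2 ^ (n + 2) * (1 + 2 * v) * hd

theorem exists_doublingIterate_eval_iterate {f : ℤ_[2][X]}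
    (hd : ∀ x : ℤ_[2], 2 ∣ f.derivative.eval x - 1) {n : ℕ}
    (h0 : ∃ v : ℤ_[2], (f.doublingIterate (n + 1)).eval 0 = 2 ^ (n + 1) * (1 + 2 * v)) (j : ℕ) :
    ∃ v : ℤ_[2], (f.doublingIterate (n + 1)).eval ((fun z => f.eval z)^[j] 0) =
      (fun z => f.eval z)^[j] 0 + 2 ^ (n + 1) * (1 + 2 * v) := by
  induction j with
  | zero => simpa using h0
  | succ j ih =>
    obtain ⟨v, hv⟩ := ih
    rw [Function.iterate_succ_apply']
    set y := (fun z => f.eval z)^[j] 0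
    have hcomm : (f.doublingIterate (n + 1)).eval (f.eval y) =
        f.eval ((f.doublingIterate (n + 1)).eval y) := by
      rw [eval_doublingIterate, eval_doublingIterate]
      exact Function.iterate_succ_apply (fun z => f.eval z) _ y ▸
        Function.iterate_succ_apply' (fun z => f.eval z) _ y
    obtain ⟨d, hd⟩ := hd y
    obtain ⟨k, hk⟩ := f.binomExpansion y (2 ^ (n + 1) * (1 + 2 * v))
    refine ⟨v + d * (1 + 2 * v) + k * 2 ^ n * (1 + 2 * v) ^ 2, ?_⟩
    rw [hcomm, hv, hk]
    linear_combination 2 ^ (n + 1) * (1 + 2 * v) * hd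

theorem exists_two_pow_dvd_iterate_eval_sub {f : ℤ_[2][X]} {x : ℤ_[2]}
    (h : ∀ n j : ℕ, ∃ v : ℤ_[2], (f.doublingIterate n).eval ((fun z => f.eval z)^[j] x) =
      (fun z => f.eval z)^[j] x + 2 ^ n * (1 + 2 * v)) (n : ℕ) (y : ℤ_[2]) :
    ∃ k, 2 ^ n ∣ (fun z => f.eval z)^[k] x - y := by
  induction n with
  | zero => exact ⟨0, by simp⟩
  | succ n ih =>
    obtain ⟨k, c, hc⟩ := ih
    rcases PadicInt.two_dvd_or_two_dvd_sub_one c with ⟨d, hd⟩ | ⟨d, hd⟩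
    · exact ⟨k, d, by rw [hc, hd]; ring⟩
    · obtain ⟨v, hv⟩ := h n k
      refine ⟨2 ^ n + k, d + 1 + v, ?_⟩
      rw [eval_doublingIterate, ← Function.iterate_add_apply] at hv
      linear_combination hv + hc + 2 ^ n * hd

/-- If the `2 ^ n`-th iterates of `f` move every point of the orbit of `0` by `2 ^ n` times a unit,
then every orbit is dense. -/
theorem dense_range_iterate_of_doublingIterate {f : ℤ_[2][X]}
    (h : ∀ n j : ℕ, ∃ v : ℤ_[2], (f.doublingIterate n).eval ((fun z => f.eval z)^[j] 0) =
      (fun z => f.eval z)^[j] 0 + 2 ^ n * (1 + 2 * v)) (x : ℤ_[2]) :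
    Dense (Set.range fun k : ℕ => (fun z : ℤ_[2] => f.eval z)^[k] x) := by
  rw [PadicInt.dense_iff_forall_exists_pow_dvd_sub]
  intro y n
  obtain ⟨j, hj⟩ := exists_two_pow_dvd_iterate_eval_sub h n x
  obtain ⟨k, hk⟩ := exists_two_pow_dvd_iterate_eval_sub (f := f)
    (x := (fun z => f.eval z)^[j] 0) (fun n i => by
      rw [← Function.iterate_add_apply]; exact h n (i + j)) n y
  refine ⟨_, ⟨k, rfl⟩, ?_⟩
  simpa using dvd_sub hk (f.dvd_iterate_eval_sub hj k)

theorem dense_range_iterate_of_congruences {f : ℤ_[2][X]} (hf0 : f.coeff 0 = 1) {A : ℤ_[2]}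
    (hA : 4 ∣ f.derivative.eval 1 + 2 * (hasseDeriv 2 f).eval 1 - A)
    (ha1 : 2 ∣ f.coeff 1 - 1) (hA1 : 2 ∣ A - 1) (hF : 4 ∣ f.eval 1 - 2)
    (h4 : 4 ∣ 2 * f.coeff 2 + f.coeff 1 * A - 1) (x : ℤ_[2]) :
    Dense (Set.range fun k : ℕ => (fun z : ℤ_[2] => f.eval z)^[k] x) := by
  have h8 := eight_dvd_eval_four_sub hf0 hA ha1 hA1 hF
  obtain ⟨r, hr⟩ := hA
  obtain ⟨c, hc⟩ := hA1
  obtain ⟨t, ht⟩ := hF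
  have hd := two_dvd_eval_derivative_sub_one ha1
    ⟨2 * r + c - (hasseDeriv 2 f).eval 1, by linear_combination hr + hc⟩
  have hs := two_dvd_eval_sub_add_one hf0 ⟨2 * t + 1, by linear_combination ht⟩
  have e0 : f.eval 0 = 1 := by rw [← coeff_zero_eq_eval_zero, hf0]
  have hz := exists_doublingIterate_eval_zero
    (four_dvd_eval_derivative_doublingIterate_sub_one hd hs) (by
      obtain ⟨a, ha⟩ := h4
      obtain ⟨b, hb⟩ := h8
      simp only [doublingIterate, eval_comp]
      exact ⟨a + b, by linear_combination hb + 2 * ha⟩)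
  refine dense_range_iterate_of_doublingIterate (fun n j => ?_) x
  match n with
  | 0 =>
    obtain ⟨v, hv⟩ := hs ((fun z => f.eval z)^[j] 0)
    refine ⟨v, ?_⟩
    rw [doublingIterate]
    linear_combination hv
  | 1 =>
    refine exists_doublingIterate_eval_iterate hd ⟨t, ?_⟩ j
    simp only [doublingIterate, eval_comp, e0]
    linear_combination ht
  | n + 2 => exact exists_doublingIterate_eval_iterate hd (hz n) j

theorem congruences_of_dense_range_iterate {f : ℤ_[2][X]} (hf0 : f.coeff 0 = 1) {A : ℤ_[2]}
    (hA : 4 ∣ f.derivative.eval 1 + 2 * (hasseDeriv 2 f).eval 1 - A)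
    (h : ∀ x : ℤ_[2], Dense (Set.range fun k : ℕ => (fun z : ℤ_[2] => f.eval z)^[k] x)) :
    2 ∣ f.coeff 1 - 1 ∧ 2 ∣ A - 1 ∧ 4 ∣ f.eval 1 - 2 ∧
      4 ∣ 2 * f.coeff 2 + f.coeff 1 * A - 1 := by
  have hit : ∀ (n : ℕ) (s y : ℤ_[2]), ∃ k, 2 ^ n ∣ (fun z => f.eval z)^[k] s - y := by
    intro n s y
    obtain ⟨_, ⟨k, rfl⟩, hk⟩ := (PadicInt.dense_iff_forall_exists_pow_dvd_sub _).1 (h s) y n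
    exact ⟨k, hk⟩
  have hit2 : ∀ s y : ℤ_[2], ∃ k, 2 ∣ (fun z => f.eval z)^[k] s - y := by simpa using hit 1
  have hit4 : ∀ s y : ℤ_[2], ∃ k, 4 ∣ (fun z => f.eval z)^[k] s - y := by
    convert hit 2 using 5; norm_num
  have hit8 : ∀ s y : ℤ_[2], ∃ k, 8 ∣ (fun z => f.eval z)^[k] s - y := by
    convert hit 3 using 5; norm_num
  have n1 := PadicInt.not_two_dvd_one
  have n2 := PadicInt.not_four_dvd_two
  have n4 := PadicInt.not_eight_dvd_four
  have e0 : f.eval 0 = 1 := by rw [← coeff_zero_eq_eval_zero, hf0]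
  -- `f` swaps the classes modulo `2`
  have hF2 : 2 ∣ f.eval 1 := by
    refine (PadicInt.two_dvd_or_two_dvd_sub_one _).resolve_right fun hF => n1 ?_
    obtain ⟨k, hk, hd⟩ := f.exists_lt_dvd_iterate_eval_sub one_pos
      (by simpa using hF) (hit2 1 0)
    interval_cases k
    simpa using hd
  obtain ⟨s, hs⟩ := hF2
  have hF : 4 ∣ f.eval 1 - 2 := by
    rcases PadicInt.two_dvd_or_two_dvd_sub_one s with ⟨t, ht⟩ | ⟨t, ht⟩
    · exfalso
      obtain ⟨k, hk, c, hc⟩ := f.exists_lt_dvd_iterate_eval_sub (s := 0) (m := 2) two_pos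
        ⟨t, by simp [e0]; linear_combination hs + 2 * ht⟩ (hit4 0 2)
      interval_cases k <;> simp [e0] at hc
      · exact n2 ⟨-c, by linear_combination -hc⟩
      · exact n1 ⟨1 + 2 * c, by linear_combination hc⟩
    · exact ⟨t, by linear_combination hs + 2 * ht⟩
  obtain ⟨t, ht⟩ := id hF
  obtain ⟨k0, hk0⟩ := exists_eval_eq_cubic_remainder f (f.eval 1)
  obtain ⟨r, hr⟩ := id hA
  have ha1 : 2 ∣ f.coeff 1 - 1 := by
    refine (PadicInt.two_dvd_or_two_dvd_sub_one _).resolve_left ?_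
    rintro ⟨b, hb⟩
    obtain ⟨k, hk, c, hc⟩ := f.exists_lt_dvd_iterate_eval_sub (s := 1) (m := 2) two_pos
      ⟨b * s + f.coeff 2 * s ^ 2 + 2 * k0 * s ^ 3, by
        simp only [Function.iterate_succ_apply, Function.iterate_zero_apply]
        rw [hk0, hf0, hs, hb]; ring⟩ (hit4 1 3)
    interval_cases k <;> simp at hc
    · exact n2 ⟨-c, by linear_combination -hc⟩
    · exact n1 ⟨2 * t - 2 * c, by linear_combination ht - hc⟩
  obtain ⟨b, hb⟩ := id ha1
  have hA1 : 2 ∣ A - 1 := by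
    refine (PadicInt.two_dvd_or_two_dvd_sub_one _).resolve_left ?_
    rintro ⟨a, ha⟩
    obtain ⟨k1, hk1⟩ := exists_eval_one_add_eq_cubic_remainder f (f.eval (f.eval 1) - 1)
    obtain ⟨m, hm⟩ : 2 ∣ f.eval (f.eval 1) - 1 :=
      ⟨f.coeff 1 * s + 2 * f.coeff 2 * s ^ 2 + 4 * k0 * s ^ 3, by rw [hk0, hf0, hs]; ring⟩
    rw [add_sub_cancel, hm] at hk1
    obtain ⟨k, hk, c, hc⟩ := f.exists_lt_dvd_iterate_eval_sub (s := f.eval 1) (m := 2) two_pos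
      ⟨(a + 2 * r - (hasseDeriv 2 f).eval 1) * m + (hasseDeriv 2 f).eval 1 * m ^ 2
          + 2 * k1 * m ^ 3, by
        simp only [Function.iterate_succ_apply, Function.iterate_zero_apply]
        rw [hk1]; linear_combination 2 * m * hr + 2 * m * ha⟩ (hit4 (f.eval 1) 0)
    interval_cases k <;> simp at hc
    · exact n2 ⟨c - t, by linear_combination hc - ht⟩
    · exact n1 ⟨2 * c - m, by linear_combination hc - hm⟩
  refine ⟨ha1, hA1, hF, ?_⟩
  obtain ⟨a, ha⟩ := id hA1
  obtain ⟨q, hq⟩ := eight_dvd_eval_four_sub hf0 hA ha1 hA1 hF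
  obtain ⟨w, hw⟩ : 2 ∣ 2 * f.coeff 2 + f.coeff 1 * A - 1 :=
    ⟨f.coeff 2 + b * A + a, by linear_combination A * hb + ha⟩
  rcases PadicInt.two_dvd_or_two_dvd_sub_one w with ⟨v, hv⟩ | ⟨v, hv⟩
  · exact ⟨v, by linear_combination hw + 2 * hv⟩
  · exfalso
    obtain ⟨k, hk, c, hc⟩ := f.exists_lt_dvd_iterate_eval_sub (s := 0) (m := 4) (by norm_num)
      ⟨q + 1 + v, by
        simp only [Function.iterate_succ_apply, Function.iterate_zero_apply]
        linear_combination hq + 2 * hw + 4 * hv⟩ (hit8 0 4)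
    interval_cases k <;> simp [e0] at hc
    · exact n4 ⟨-c, by linear_combination -hc⟩
    · exact n1 ⟨4 * c + 2, by linear_combination hc⟩
    · exact n2 ⟨2 * c - t + 1, by linear_combination hc - ht⟩
    · rw [hk0, hf0, hs] at hc
      exact n1 ⟨4 * c + 2 - (f.coeff 1 * s + 2 * f.coeff 2 * s ^ 2 + 4 * k0 * s ^ 3),
        by linear_combination hc⟩

end Polynomial

/-- For `f(x) = 1 + a₁x + ⋯ + a_d x^d` over `ℤ_[2]`, with `A₁` the sum of the odd-index
coefficients and `A₂` the sum of the even-index coefficients (`i ≥ 2`), the system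
`(ℤ₂, f)` is minimal iff `a₁ ≡ 1 (mod 2)`, `A₁ ≡ 1 (mod 2)`, `A₁ + A₂ ≡ 1 (mod 4)` and
`2a₂ + a₁A₁ ≡ 1 (mod 4)`. -/
theorem stmt_6 (f : Polynomial ℤ_[2]) (hf0 : f.coeff 0 = 1) :
    (∀ x : ℤ_[2], Dense (Set.range fun k : ℕ => (fun z : ℤ_[2] => f.eval z)^[k] x)) ↔
      ((2 : ℤ_[2]) ∣ (f.coeff 1 - 1) ∧
        (2 : ℤ_[2]) ∣
          ((∑ i ∈ (Finset.range (f.natDegree + 1)).filter (fun i => i % 2 = 1), f.coeff i) - 1) ∧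
        (4 : ℤ_[2]) ∣
          ((∑ i ∈ (Finset.range (f.natDegree + 1)).filter (fun i => i % 2 = 1), f.coeff i) +
            (∑ i ∈ (Finset.range (f.natDegree + 1)).filter
              (fun i => i % 2 = 0 ∧ i ≠ 0), f.coeff i) - 1) ∧
        (4 : ℤ_[2]) ∣
          (2 * f.coeff 2 +
            f.coeff 1 *
              (∑ i ∈ (Finset.range (f.natDegree + 1)).filter (fun i => i % 2 = 1), f.coeff i) -
            1)) := by
  have hA := four_dvd_eval_one_derivative_add f
  have hF := eval_one_eq_coeff_zero_add_odd_add_even f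
  have hF' : ∀ B C : ℤ_[2], f.eval 1 = f.coeff 0 + (B + C) → B + C - 1 = f.eval 1 - 2 :=
    fun B C h => by rw [h, hf0]; ring
  rw [hF' _ _ hF]
  exact ⟨congruences_of_dense_range_iterate hf0 hA, fun ⟨ha1, hA1, hF, h4⟩ =>
    dense_range_iterate_of_congruences hf0 hA ha1 hA1 hF h4⟩
end

section
/- Let f(x) = 1 + a₁x + a₂x² + ⋯ + a_d x^d be a polynomial with coefficients in ℤ₅ and constant term 1. Set A₁ = Σ_{i ≥ 1, i ≡ 1 (mod 4)} a_i, A₂ = Σ_{i ≡ 2 (mod 4)} a_i, A₃ = Σ_{i ≡ 3 (mod 4)} a_i, A₄ = Σ_{i ≥ 4, i ≡ 0 (mod 4)} a_i. Then the induced map f_/1 on ℤ/5ℤ is minimal (every forward orbit of f_/1 is all of ℤ/5ℤ) if and only if the quadruple (A₁, A₂, A₃, A₄) reduced mod 5 is one of the six tuples: (1,0,0,0), (4,4,3,0), (1,3,3,0), (1,4,2,0), (4,2,2,0), (0,0,3,0). -/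
open Polynomial

instance : Fact (Nat.Prime 5) := ⟨by norm_num⟩

/-- The sum of the coefficients of `f` whose index `i` satisfies `i ≥ 1` and
`i ≡ r (mod 4)`. -/
noncomputable def Acoef (f : Polynomial ℤ_[5]) (r : ℕ) : ℤ_[5] :=
  ∑ i ∈ (Finset.range (f.natDegree + 1)).filter (fun i => i ≠ 0 ∧ i % 4 = r % 4), f.coeff i

/-- If every forward orbit of `g` is everything, each orbit is exhausted by its first `card α`
points. -/
theorem exists_lt_card_iterate_eq {α : Type*} [Fintype α] {g : α → α}
    (hg : ∀ x y, ∃ k : ℕ, g^[k] x = y) (x y : α) :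
    ∃ k < Fintype.card α, g^[k] x = y := by
  obtain ⟨m, hm⟩ := hg (g x) x
  have hx : x ∈ Function.periodicPts g :=
    ⟨m + 1, m.succ_pos, by simpa [Function.IsPeriodicPt, Function.IsFixedPt] using hm⟩
  obtain ⟨k, rfl⟩ := hg x y
  have hle : Function.minimalPeriod g x ≤ Fintype.card α := by
    simpa using Fintype.card_le_of_injective
      (fun i : Fin (Function.minimalPeriod g x) => g^[i] x)
      (fun i j hij => Fin.ext <|
        (Function.iterate_eq_iterate_iff_of_lt_minimalPeriod i.2 j.2).1 hij)
  exact ⟨k % Function.minimalPeriod g x,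
    (Nat.mod_lt _ (Function.minimalPeriod_pos_of_mem_periodicPts hx)).trans_le hle,
    Function.iterate_mod_minimalPeriod_eq⟩

theorem ZMod.five_pow_eq_pow_mod (z : ZMod 5) {i r : ℕ} (hi : i ≠ 0) (hr : r ≠ 0)
    (h : i % 4 = r % 4) : z ^ i = z ^ r := by
  by_cases hz : z = 0
  · simp [hz, hi, hr]
  · have h4 : z ^ 4 = 1 := ZMod.pow_card_sub_one_eq_one hz
    rw [← Nat.div_add_mod i 4, ← Nat.div_add_mod r 4, h]
    simp [pow_add, pow_mul, h4]

theorem toZMod_Acoef_mul_pow (f : Polynomial ℤ_[5]) {r : ℕ} (hr : r ≠ 0) (z : ZMod 5) :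
    PadicInt.toZMod (Acoef f r) * z ^ r =
      ∑ i ∈ (Finset.range (f.natDegree + 1)).filter (fun i => i ≠ 0 ∧ i % 4 = r % 4),
        PadicInt.toZMod (f.coeff i) * z ^ i := by
  rw [Acoef, map_sum, Finset.sum_mul]
  refine Finset.sum_congr rfl fun i hi => ?_
  obtain ⟨-, hi, hir⟩ := Finset.mem_filter.1 hi
  rw [ZMod.five_pow_eq_pow_mod z hi hr hir]

theorem eval_map_toZMod_eq_Acoef (f : Polynomial ℤ_[5]) (z : ZMod 5) :
    (f.map PadicInt.toZMod).eval z =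
      PadicInt.toZMod (f.coeff 0) + PadicInt.toZMod (Acoef f 1) * z ^ 1 +
        PadicInt.toZMod (Acoef f 2) * z ^ 2 + PadicInt.toZMod (Acoef f 3) * z ^ 3 +
        PadicInt.toZMod (Acoef f 4) * z ^ 4 := by
  have h0 : PadicInt.toZMod (f.coeff 0) = ∑ i ∈ Finset.range (f.natDegree + 1),
      if i = 0 then PadicInt.toZMod (f.coeff i) * z ^ i else 0 := by
    simp
  rw [toZMod_Acoef_mul_pow f one_ne_zero, toZMod_Acoef_mul_pow f two_ne_zero,
    toZMod_Acoef_mul_pow f three_ne_zero, toZMod_Acoef_mul_pow f four_ne_zero, h0,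
    eval_map, eval₂_eq_sum_range]
  simp only [Finset.sum_filter, ← Finset.sum_add_distrib]
  refine Finset.sum_congr rfl fun i _ => ?_
  by_cases hi : i = 0
  · simp [hi]
  · have : i % 4 < 4 := Nat.mod_lt _ (by norm_num)
    interval_cases i % 4 <;> simp [hi]

theorem coeffs_of_minimal_quartic_zmod_five : ∀ a b c d : ZMod 5,
    (∀ x y : ZMod 5, ∃ k < 5,
      (fun z : ZMod 5 => 1 + a * z ^ 1 + b * z ^ 2 + c * z ^ 3 + d * z ^ 4)^[k] x = y) →
    (a, b, c, d) = (1, 0, 0, 0) ∨ (a, b, c, d) = (4, 4, 3, 0) ∨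
      (a, b, c, d) = (1, 3, 3, 0) ∨ (a, b, c, d) = (1, 4, 2, 0) ∨
      (a, b, c, d) = (4, 2, 2, 0) ∨ (a, b, c, d) = (0, 0, 3, 0) := by
  decide +kernel

theorem minimal_quartic_zmod_five_iff (a b c d : ZMod 5) :
    (∀ x y : ZMod 5, ∃ k : ℕ,
      (fun z : ZMod 5 => 1 + a * z ^ 1 + b * z ^ 2 + c * z ^ 3 + d * z ^ 4)^[k] x = y) ↔
    (a, b, c, d) = (1, 0, 0, 0) ∨ (a, b, c, d) = (4, 4, 3, 0) ∨
      (a, b, c, d) = (1, 3, 3, 0) ∨ (a, b, c, d) = (1, 4, 2, 0) ∨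
      (a, b, c, d) = (4, 2, 2, 0) ∨ (a, b, c, d) = (0, 0, 3, 0) := by
  refine ⟨fun h => coeffs_of_minimal_quartic_zmod_five a b c d
    (exists_lt_card_iterate_eq h), fun h => ?_⟩
  suffices ∀ x y : ZMod 5, ∃ k < 5,
      (fun z : ZMod 5 => 1 + a * z ^ 1 + b * z ^ 2 + c * z ^ 3 + d * z ^ 4)^[k] x = y from
    fun x y => (this x y).imp fun _ hk => hk.2
  simp only [Prod.mk.injEq] at h
  rcases h with ⟨rfl, rfl, rfl, rfl⟩ | ⟨rfl, rfl, rfl, rfl⟩ | ⟨rfl, rfl, rfl, rfl⟩ |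
    ⟨rfl, rfl, rfl, rfl⟩ | ⟨rfl, rfl, rfl, rfl⟩ | ⟨rfl, rfl, rfl, rfl⟩ <;> decide +kernel

/-- For `f(x) = 1 + a₁x + ⋯ + a_d x^d` over `ℤ_[5]`, the induced map `f_/1` on `ℤ/5ℤ`
is minimal iff `(A₁, A₂, A₃, A₄)` reduced mod 5 is one of `(1,0,0,0)`, `(4,4,3,0)`,
`(1,3,3,0)`, `(1,4,2,0)`, `(4,2,2,0)`, `(0,0,3,0)`. -/
theorem stmt_9 (f : Polynomial ℤ_[5]) (hf0 : f.coeff 0 = 1) :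
    (∀ x y : ZMod 5,
        ∃ k : ℕ, (fun z : ZMod 5 => (f.map PadicInt.toZMod).eval z)^[k] x = y) ↔
      ((PadicInt.toZMod (Acoef f 1), PadicInt.toZMod (Acoef f 2),
          PadicInt.toZMod (Acoef f 3), PadicInt.toZMod (Acoef f 4)) = (1, 0, 0, 0) ∨
        (PadicInt.toZMod (Acoef f 1), PadicInt.toZMod (Acoef f 2),
          PadicInt.toZMod (Acoef f 3), PadicInt.toZMod (Acoef f 4)) = (4, 4, 3, 0) ∨
        (PadicInt.toZMod (Acoef f 1), PadicInt.toZMod (Acoef f 2),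
          PadicInt.toZMod (Acoef f 3), PadicInt.toZMod (Acoef f 4)) = (1, 3, 3, 0) ∨
        (PadicInt.toZMod (Acoef f 1), PadicInt.toZMod (Acoef f 2),
          PadicInt.toZMod (Acoef f 3), PadicInt.toZMod (Acoef f 4)) = (1, 4, 2, 0) ∨
        (PadicInt.toZMod (Acoef f 1), PadicInt.toZMod (Acoef f 2),
          PadicInt.toZMod (Acoef f 3), PadicInt.toZMod (Acoef f 4)) = (4, 2, 2, 0) ∨
        (PadicInt.toZMod (Acoef f 1), PadicInt.toZMod (Acoef f 2),
          PadicInt.toZMod (Acoef f 3), PadicInt.toZMod (Acoef f 4)) = (0, 0, 3, 0)) := by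
  simp only [eval_map_toZMod_eq_Acoef, hf0, map_one]
  exact minimal_quartic_zmod_five_iff _ _ _ _
end

section
/- Let f(x) = 1 + a₁x + a₂x² + ⋯ + a_d x^d be a polynomial with coefficients in ℤ₅ and constant term 1, with D₁ = f′(1), D₋₁ = f′(−1), D₂ = f′(2), D₋₂ = f′(−2). If (ℤ₅, f) is minimal, then a₁ · D₁ · D₂ · D₋₂ · D₋₁ ≡ 1 (mod 5). -/
open Polynomial

theorem PadicInt.exists_pow_dvd_sub_of_dense_range {p : ℕ} [Fact p.Prime] {ι : Type*}
    {u : ι → ℤ_[p]} (hu : Dense (Set.range u)) (n : ℕ) (z : ℤ_[p]) :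
    ∃ k, (p : ℤ_[p]) ^ n ∣ u k - z := by
  have hp : (0 : ℝ) < (p : ℝ) ^ (-(n : ℤ)) :=
    zpow_pos (by exact_mod_cast (Fact.out : p.Prime).pos) _
  obtain ⟨_, ⟨k, rfl⟩, hk⟩ := hu.exists_dist_lt z hp
  refine ⟨k, ?_⟩
  rw [← Ideal.mem_span_singleton, ← PadicInt.norm_le_pow_iff_mem_span_pow, norm_sub_rev,
    ← dist_eq_norm]
  exact hk.le

theorem Polynomial.map_iterate_eval {R S : Type*} [CommSemiring R] [CommSemiring S] (φ : R →+* S)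
    (f : R[X]) (k : ℕ) (x : R) :
    φ ((fun z => f.eval z)^[k] x) = (fun z => (f.map φ).eval z)^[k] (φ x) :=
  Function.Semiconj.iterate_right (f := φ) (fun z => by simp) k x

/-- A self-map of a finite type all of whose forward orbits are everything is a single cycle. -/
theorem Function.exists_perm_isCycleOn_of_forall_exists_iterate {α : Type*} [Finite α] {g : α → α}
    (hg : ∀ x y, ∃ k, g^[k] x = y) :
    ∃ σ : Equiv.Perm α, ⇑σ = g ∧ σ.IsCycleOn Set.univ := by
  have hs : Function.Surjective g := fun y => by
    obtain ⟨k, hk⟩ := hg (g y) y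
    exact ⟨g^[k] y, by rw [← Function.iterate_succ_apply' g, Function.iterate_succ_apply, hk]⟩
  let σ := Equiv.ofBijective g ⟨Finite.injective_iff_surjective.2 hs, hs⟩
  refine ⟨σ, rfl, ⟨by simpa using σ.bijective, fun x _ y _ => ?_⟩⟩
  obtain ⟨k, hk⟩ := hg x y
  exact ⟨k, by rw [zpow_natCast, ← Equiv.Perm.iterate_eq_pow]; exact hk⟩

theorem Polynomial.eval_derivative_iterate_comp {R : Type*} [CommRing R] (f : R[X]) (n : ℕ)
    (x : R) :
    (derivative (f.comp^[n] X)).eval x =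
      ∏ i ∈ Finset.range n, (derivative f).eval ((fun z => f.eval z)^[i] x) := by
  induction n with
  | zero => simp
  | succ n ih =>
    rw [Function.iterate_succ_apply', derivative_comp, Finset.prod_range_succ, eval_mul, ih,
      eval_comp, iterate_comp_eval, eval_X]

/-- For `f(x) = 1 + a₁x + ⋯ + a_d x^d` over `ℤ_[5]`, if `(ℤ₅, f)` is minimal then
`a₁ · f′(1) · f′(2) · f′(-2) · f′(-1) ≡ 1 (mod 5)`. -/
theorem stmt_18 (f : Polynomial ℤ_[5]) (hf0 : f.coeff 0 = 1)
    (hmin : ∀ x : ℤ_[5], Dense (Set.range fun k : ℕ => (fun z : ℤ_[5] => f.eval z)^[k] x)) :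
    (5 : ℤ_[5]) ∣
      (f.coeff 1 * (derivative f).eval 1 * (derivative f).eval 2 *
          (derivative f).eval (-2) * (derivative f).eval (-1) - 1) := by
  have hdvd (a : ℤ_[5]) : (5 : ℤ_[5]) ∣ a ↔ PadicInt.toZMod a = 0 := by
    rw [← RingHom.mem_ker, PadicInt.ker_toZMod, PadicInt.maximalIdeal_eq_span_p,
      Ideal.mem_span_singleton]
    simp
  set φ : ℤ_[5] →+* ZMod 5 := PadicInt.toZMod
  obtain ⟨σ, hσ, hcyc⟩ := Function.exists_perm_isCycleOn_of_forall_exists_iterate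
    (g := fun z : ZMod 5 => (f.map φ).eval z) (fun x y => by
      obtain ⟨x, rfl⟩ := ZMod.ringHom_surjective φ x
      obtain ⟨y, rfl⟩ := ZMod.ringHom_surjective φ y
      obtain ⟨k, hk⟩ := PadicInt.exists_pow_dvd_sub_of_dense_range (hmin x) 1 y
      refine ⟨k, ?_⟩
      rw [← map_iterate_eval, ← sub_eq_zero, ← map_sub, ← hdvd]
      simpa using hk)
  rw [← Finset.coe_univ] at hcyc
  have hit (i : ℕ) (x : ℤ_[5]) : φ ((fun z => f.eval z)^[i] x) = (σ ^ i) (φ x) := by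
    rw [map_iterate_eval, ← hσ, Equiv.Perm.iterate_eq_pow]
  set F := f.comp^[5] X
  have hF (x : ℤ_[5]) : F.eval x = (fun z => f.eval z)^[5] x := by
    rw [iterate_comp_eval, eval_X]
  have hD : φ ((derivative F).eval 0) = ∏ x : ZMod 5, (derivative (f.map φ)).eval x := by
    rw [eval_derivative_iterate_comp, map_prod]
    have himg : (Finset.range 5).image (fun n => (σ ^ n) (0 : ZMod 5)) = Finset.univ := by
      refine Finset.eq_univ_of_forall fun y => ?_
      obtain ⟨n, hn, hy⟩ := hcyc.exists_pow_eq (Finset.mem_univ 0) (Finset.mem_univ y)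
      rw [Finset.card_univ, ZMod.card] at hn
      exact Finset.mem_image.2 ⟨n, Finset.mem_range.2 hn, hy⟩
    have hinj : Set.InjOn (fun n => (σ ^ n) (0 : ZMod 5)) (Finset.range 5) := by
      apply Finset.injOn_of_card_image_eq
      rw [himg, Finset.card_univ, ZMod.card, Finset.card_range]
    rw [← himg, Finset.prod_image hinj]
    refine Finset.prod_congr rfl fun i _ => ?_
    have h := hit i 0
    rw [map_zero] at h
    rw [← h, derivative_map, eval_map_apply]
  have hgoal : φ (f.coeff 1 * (derivative f).eval 1 * (derivative f).eval 2 *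
      (derivative f).eval (-2) * (derivative f).eval (-1) - 1) =
      φ ((derivative F).eval 0 - 1) := by
    have h0 : f.coeff 1 = (derivative f).eval 0 := by
      rw [← coeff_zero_eq_eval_zero, coeff_derivative]; simp
    rw [map_sub, map_sub, hD, h0]
    simp only [map_mul, ← eval_map_apply, ← derivative_map, map_zero, map_one, map_neg, map_ofNat]
    congr 1
    have h2 : (-2 : ZMod 5) = 3 := rfl
    have h1 : (-1 : ZMod 5) = 4 := rfl
    rw [h1, h2]
    exact (Fin.prod_univ_five fun x : ZMod 5 => (derivative (f.map φ)).eval x).symm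
  rw [hdvd, hgoal]
  by_contra hne
  have hunit : IsUnit ((derivative F).eval 0 - 1) := by
    by_contra hn
    exact hne (RingHom.mem_ker.1 (by
      rw [PadicInt.ker_toZMod]; exact (IsLocalRing.mem_maximalIdeal _).2 hn))
  obtain ⟨b, hb⟩ : (5 : ℤ_[5]) ∣ F.eval 0 := by
    have h := hcyc.pow_card_apply (Finset.mem_univ (0 : ZMod 5))
    rw [Finset.card_univ, ZMod.card] at h
    rw [hdvd, hF, hit, map_zero, h]
  obtain ⟨c, hc⟩ := hunit.exists_right_inv
  set x : ℤ_[5] := 5 * (-b * c) with hx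
  have hfix : (5 : ℤ_[5]) ^ 2 ∣ F.eval x - x := by
    obtain ⟨r, hr⟩ := F.binomExpansion 0 x
    rw [zero_add] at hr
    refine ⟨r * (-b * c) ^ 2, ?_⟩
    rw [hr, hb, hx]
    linear_combination (-5 * b) * hc
  let ψ : ℤ_[5] →+* ZMod (5 ^ 2) := PadicInt.toZModPow 2
  have hψ {a b : ℤ_[5]} (h : (5 : ℤ_[5]) ^ 2 ∣ a - b) : ψ a = ψ b := by
    rw [← sub_eq_zero, ← map_sub, ← RingHom.mem_ker, PadicInt.ker_toZModPow,
      Ideal.mem_span_singleton]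
    exact_mod_cast h
  have hper : Function.IsPeriodicPt (fun z => (f.map ψ).eval z) 5 (ψ x) := by
    rw [Function.IsPeriodicPt, Function.IsFixedPt, ← map_iterate_eval, ← hF, hψ hfix]
  have hsurj : Function.Surjective
      fun i : Fin 5 => (fun z => (f.map ψ).eval z)^[(i : ℕ)] (ψ x) := fun y => by
    obtain ⟨y, rfl⟩ := ZMod.ringHom_surjective ψ y
    obtain ⟨k, hk⟩ := PadicInt.exists_pow_dvd_sub_of_dense_range (hmin x) 2 y
    refine ⟨⟨k % 5, Nat.mod_lt _ (by norm_num)⟩, ?_⟩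
    rw [← hψ hk, map_iterate_eval]
    exact hper.iterate_mod_apply k
  have hcard := Fintype.card_le_of_surjective _ hsurj
  rw [ZMod.card, Fintype.card_fin] at hcard
  norm_num at hcard
end

section
/- The polynomial map f : ℤ₅ → ℤ₅ given by f(x) = 5x⁵ + 10x⁴ − 5x² − 4x + 1 is minimal, i.e., for every x ∈ ℤ₅ the forward orbit {fᵏ(x) : k ≥ 0} is dense in ℤ₅. -/
open Polynomial in
/-- Second-order Taylor expansion of the iterates of `z ↦ z + q * G z`, with polynomial remainder. -/
theorem exists_iterate_eq_add_pow_three_mul {R : Type*} [CommRing R] (q : R) (G : R[X]) (g : R → R)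
    (hg : ∀ z, g z = z + q * G.eval z) (i : ℕ) :
    ∃ S : R[X], ∀ z, g^[i] z = z + i * q * G.eval z
      + (i.choose 2 : R) * q ^ 2 * (G.eval z * (derivative G).eval z) + q ^ 3 * S.eval z := by
  induction i with
  | zero => exact ⟨0, fun z => by simp⟩
  | succ i ih =>
    obtain ⟨S, hS⟩ := ih
    let T : R[X] := (i.choose 2 : R[X]) * (G * derivative G) + C q * S
    let D : R[X] := (i : R[X]) * G + C q * T
    obtain ⟨k, hk⟩ := (G.map C).binomExpansion X (C q * D)
    have hG : ∀ z, G.eval (z + q * D.eval z) = G.eval z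
        + (derivative G).eval z * (q * D.eval z) + k.eval z * (q * D.eval z) ^ 2 := fun z => by
      have h := congrArg (eval z) hk
      rw [eval_map, ← Polynomial.comp, eval_comp] at h
      simpa [eval_map, derivative_map] using h
    refine ⟨S + derivative G * T + k * D ^ 2, fun z => ?_⟩
    have hz : g^[i] z = z + q * D.eval z := by
      rw [hS]
      simp [D, T]
      ring
    rw [Function.iterate_succ_apply', hg, hz, hG, Nat.choose_succ_succ' i 1]
    simp [D, T]
    ring

open Polynomial in
/-- If `f^[5] z = z + 5 * G z` with `G ≡ -1` modulo `5`, then `f^[5 ^ n] z = z + 5 ^ n * G' z` with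
`G' ≡ -1` modulo `5` for all positive `n`. -/
theorem exists_iterate_five_pow {R : Type*} [CommRing R] (f : R → R)
    (h : ∃ G : R[X], (∀ z, f^[5] z = z + 5 * G.eval z) ∧ ∀ z, 5 ∣ G.eval z + 1) (n : ℕ) :
    ∃ G : R[X], (∀ z, f^[5 ^ (n + 1)] z = z + 5 ^ (n + 1) * G.eval z) ∧
      ∀ z, 5 ∣ G.eval z + 1 := by
  induction n with
  | zero => simpa using h
  | succ n ih =>
    obtain ⟨G, hG, hG1⟩ := ih
    obtain ⟨S, hS⟩ := exists_iterate_eq_add_pow_three_mul _ G _ hG 5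
    refine ⟨G + C 5 * (C (2 * 5 ^ n) * (G * derivative G) + C (5 ^ (2 * n)) * S),
      fun z => ?_, fun z => ?_⟩
    · rw [pow_succ 5 (n + 1), Function.iterate_mul, hS]
      simp [Nat.choose]
      ring
    · have := (hG1 z).add (dvd_mul_right 5
        ((C (2 * 5 ^ n) * (G * derivative G) + C (5 ^ (2 * n)) * S).eval z))
      convert this using 1
      simp
      ring

open Polynomial in
theorem exists_iterate_five :
    ∃ G : ℤ_[5][X], (∀ z, (fun z : ℤ_[5] => 5 * z ^ 5 + 10 * z ^ 4 - 5 * z ^ 2 - 4 * z + 1)^[5] z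
      = z + 5 * G.eval z) ∧ ∀ z, 5 ∣ G.eval z + 1 := by
  let h : ℤ_[5][X] := X ^ 5 + C 2 * X ^ 4 - X ^ 2 - X
  let F : ℤ_[5][X] := X + 1 + C 5 * h
  refine ⟨1 + h + h.comp F + h.comp (F.comp F) + h.comp (F.comp (F.comp F))
    + h.comp (F.comp (F.comp (F.comp F))), fun z => ?_, fun z => ?_⟩
  · have hf : (fun z : ℤ_[5] => 5 * z ^ 5 + 10 * z ^ 4 - 5 * z ^ 2 - 4 * z + 1)
        = fun z => F.eval z := by
      funext z
      simp [F, h]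
      ring
    have hF : ∀ z, F.eval z = z + 1 + 5 * h.eval z := fun z => by simp [F]
    rw [hf]
    simp only [Function.iterate_succ_apply, Function.iterate_zero_apply, eval_add, eval_comp,
      eval_one]
    rw [hF (F.eval (F.eval (F.eval (F.eval z)))), hF (F.eval (F.eval (F.eval z))),
      hF (F.eval (F.eval z)), hF (F.eval z), hF z]
    ring
  · have h5 : (5 : ZMod 5) = 0 := by decide
    have hm2 : PadicInt.toZMod (2 : ℤ_[5]) = 2 := map_ofNat _ 2
    have hm5 : PadicInt.toZMod (5 : ℤ_[5]) = 0 := (map_ofNat _ 5).trans h5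
    have key : PadicInt.toZMod (eval z (1 + h + h.comp F + h.comp (F.comp F)
        + h.comp (F.comp (F.comp F)) + h.comp (F.comp (F.comp (F.comp F)))) + 1) = 0 := by
      have hh : ∀ y, PadicInt.toZMod (h.eval y) = PadicInt.toZMod y ^ 5
          + 2 * PadicInt.toZMod y ^ 4 - PadicInt.toZMod y ^ 2 - PadicInt.toZMod y :=
        fun y => by simp [h, hm2]
      have hF : ∀ y, PadicInt.toZMod (F.eval y) = PadicInt.toZMod y + 1 :=
        fun y => by simp [F, hm5]
      simp only [eval_add, eval_comp, eval_one, map_add, map_one, hh, hF]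
      generalize PadicInt.toZMod z = w
      revert w
      decide
    rwa [← RingHom.mem_ker, PadicInt.ker_toZMod, PadicInt.maximalIdeal_eq_span_p,
      Ideal.mem_span_singleton] at key

/-- The polynomial map `f(x) = 5x⁵ + 10x⁴ − 5x² − 4x + 1` is minimal on `ℤ_[5]`:
every forward orbit is dense. -/
theorem stmt_19 (x : ℤ_[5]) :
    Dense (Set.range fun k : ℕ =>
      (fun z : ℤ_[5] => 5 * z ^ 5 + 10 * z ^ 4 - 5 * z ^ 2 - 4 * z + 1)^[k] x) := by
  have h_iter := exists_iterate_five_pow _ exists_iterate_five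
  set f := fun z : ℤ_[5] => 5 * z ^ 5 + 10 * z ^ 4 - 5 * z ^ 2 - 4 * z + 1 with hf
  have h_repr : ∀ d : ℤ_[5], ∃ j : ℕ, 5 ∣ d - j := fun d => by
    refine ⟨d.zmodRepr, ?_⟩
    have := PadicInt.sub_zmodRepr_mem d
    rwa [PadicInt.maximalIdeal_eq_span_p, Ideal.mem_span_singleton] at this
  have h_one : ∀ (z : ℤ_[5]) (j : ℕ), 5 ∣ f^[j] z - (z + j) := fun z j => by
    induction j with
    | zero => simp
    | succ j ih =>
      obtain ⟨c, hc⟩ := ih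
      rw [Function.iterate_succ_apply']
      set y := f^[j] z
      refine ⟨c + (y ^ 5 + 2 * y ^ 4 - y ^ 2 - y), ?_⟩
      push_cast
      simp only [hf]
      linear_combination hc
  have key : ∀ (y : ℤ_[5]) (n : ℕ), ∃ k, 5 ^ n ∣ y - f^[k] x := fun y n => by
    induction n with
    | zero => exact ⟨0, by simp⟩
    | succ n ih =>
      obtain ⟨k, d, hd⟩ := ih
      rcases n with _ | n
      · obtain ⟨j, e, he⟩ := h_repr d
        obtain ⟨c, hc⟩ := h_one (f^[k] x) j
        refine ⟨j + k, e - c, ?_⟩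
        rw [Function.iterate_add_apply]
        linear_combination hd + he - hc
      · obtain ⟨G, hG, hG1⟩ := h_iter n
        obtain ⟨j, e, he⟩ := h_repr (-d)
        obtain ⟨S, hS⟩ := exists_iterate_eq_add_pow_three_mul _ G _ hG j
        obtain ⟨c, hc⟩ := hG1 (f^[k] x)
        refine ⟨5 ^ (n + 1) * j + k, ?_⟩
        rw [Function.iterate_add_apply, Function.iterate_mul, hS]
        set z := f^[k] x
        refine ⟨-e - j * c - 5 ^ n * ((j.choose 2 : ℤ_[5])
          * (G.eval z * (Polynomial.derivative G).eval z) + 5 ^ (n + 1) * S.eval z), ?_⟩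
        linear_combination hd - 5 ^ (n + 1) * he - 5 ^ (n + 1) * j * hc
  refine Metric.dense_iff.2 fun y r hr => ?_
  obtain ⟨n, hn⟩ := PadicInt.exists_pow_neg_lt 5 hr
  obtain ⟨k, hk⟩ := key y n
  refine ⟨f^[k] x, ?_, k, rfl⟩
  rw [Metric.mem_ball, dist_comm, dist_eq_norm]
  refine lt_of_le_of_lt ?_ hn
  rw [PadicInt.norm_le_pow_iff_mem_span_pow, Ideal.mem_span_singleton]
  exact_mod_cast hk
end
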